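/- Let G be an isometric multiple HNN extension of a finitely presented base group (A,X) with stable letters s_1,…,s_n. Every geodesic word over (X ∪ {s_1,…,s_n})^{±1} in G is stable letter reduced; equivalently, any word containing a pinch s_i^{-1} u s_i with u ∈ U_i, or s_i v s_i^{-1} with v ∈ V_i, is not geodesic. -/

import Mathlib

/-!  Common framework: words over an inverse-closed generating set, word length,
geodesics, falsification by fellow traveler property, almost convexity. -/

namespace ACPaper

section Core

variable {β G : Type*} [Group G]

/-- A letter is a generator (`Sum.inl`) or the formal inverse of a generator (`Sum.inr`);
this realizes the inverse-closed alphabet `X^{±1}`. -/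
def letterEval (gen : β → G) : β ⊕ β → G :=
  Sum.elim gen fun b => (gen b)⁻¹

/-- Evaluation of a word over `X^{±1}` in the group. -/
def eval (gen : β → G) (w : List (β ⊕ β)) : G :=
  (w.map (letterEval gen)).prod

/-- `gen` is a generating set: every element is represented by some word. -/
def Generates (gen : β → G) : Prop :=
  ∀ g : G, ∃ w : List (β ⊕ β), eval gen w = g

/-- Word length of a group element with respect to the generating set. -/
noncomputable def wlen (gen : β → G) (g : G) : ℕ :=
  sInf {n : ℕ | ∃ w : List (β ⊕ β), eval gen w = g ∧ w.length = n}

/-- A word is geodesic if its length equals the word length of the element it represents. -/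
def IsGeodesic (gen : β → G) (w : List (β ⊕ β)) : Prop :=
  w.length = wlen gen (eval gen w)

/-- The point reached after `t` steps along the unit-speed path labelled by `w`
(the path remains at its endpoint after time `w.length`). -/
def pos (gen : β → G) (w : List (β ⊕ β)) (t : ℕ) : G :=
  eval gen (w.take t)

/-- Synchronous falsification by fellow traveler property with constant `k`:
every non-geodesic word is synchronously `k`-fellow traveled by a shorter word
representing the same element. -/
def SynchFFTP (gen : β → G) (k : ℕ) : Prop :=
  ∀ w : List (β ⊕ β), ¬ IsGeodesic gen w →
    ∃ w' : List (β ⊕ β), eval gen w' = eval gen w ∧ w'.length < w.length ∧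
      ∀ t : ℕ, wlen gen ((pos gen w t)⁻¹ * pos gen w' t) ≤ k

/-- The path starting at `g` labelled by the word `w` stays in the ball of radius `N`
about the identity. -/
def PathInBall (gen : β → G) (N : ℕ) (g : G) (w : List (β ⊕ β)) : Prop :=
  ∀ t : ℕ, wlen gen (g * pos gen w t) ≤ N

/-- Almost convexity with constant `C`: any two elements of the sphere of radius `N ≥ 1`
at distance at most `2` are joined by a path of length at most `C` inside the ball of
radius `N`. -/
def AlmostConvexWith (gen : β → G) (C : ℕ) : Prop :=
  ∀ N : ℕ, 1 ≤ N → ∀ g g' : G, wlen gen g = N → wlen gen g' = N →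
    wlen gen (g⁻¹ * g') ≤ 2 →
    ∃ w : List (β ⊕ β), g * eval gen w = g' ∧ w.length ≤ C ∧ PathInBall gen N g w

/-- Almost convexity: almost convex with some positive constant. -/
def AlmostConvex (gen : β → G) : Prop :=
  ∃ C : ℕ, 0 < C ∧ AlmostConvexWith gen C


end Core

/-- Two letters are an inverse pair (`x` followed by `x⁻¹`, or `x⁻¹` followed by `x`). -/
def IsInvPair {β : Type*} : β ⊕ β → β ⊕ β → Prop
  | Sum.inl x, Sum.inr y => x = y
  | Sum.inr x, Sum.inl y => x = y
  | _, _ => False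

/-- A word over a formal alphabet `κ^{±1}` is freely reduced. -/
def FreelyReduced {κ : Type*} (l : List (κ ⊕ κ)) : Prop :=
  l.Chain' fun a b => ¬ IsInvPair a b

/-- Every geodesic word (over `X^{±1}`) representing an element of the subgroup generated
by `gens` is a concatenation of geodesic words, each representing an element of `gens` or
an inverse of one. -/
def TGConcat {β G : Type*} [Group G] (gen : β → G) (gens : Set G) : Prop :=
  ∀ w : List (β ⊕ β), IsGeodesic gen w → eval gen w ∈ Subgroup.closure gens →
    ∃ ps : List (List (β ⊕ β)), w = ps.flatten ∧
      ∀ p ∈ ps, IsGeodesic gen p ∧ ∃ g ∈ gens, eval gen p = g ∨ eval gen p = g⁻¹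

/-- Every freely reduced word in the elements `f j` and their inverses, read as a word over
`X^{±1}` (i.e. substituting geodesic representatives), is geodesic: the word length of the
element it represents is the sum of the word lengths of its letters. -/
def TGReducedGeodesic {β G κ : Type*} [Group G] (gen : β → G) (f : κ → G) : Prop :=
  ∀ l : List (κ ⊕ κ), FreelyReduced l →
    wlen gen (eval f l) =
      (l.map (Sum.elim (fun j => wlen gen (f j)) fun j => wlen gen (f j))).sum

/-- The subgroup generated by the family `f` is totally geodesic in `(G, gen)`. -/
def TotallyGeodesicSub {β G κ : Type*} [Group G] (gen : β → G) (f : κ → G) : Prop :=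
  TGConcat gen (Set.range f) ∧ TGReducedGeodesic gen f

/-- The data of a multiple HNN extension: a finitely generated base group
`A = ⟨X ∣ R⟩` and, for each stable letter `s_i` (`i ∈ Fin n`), words
`uw i j, vw i j` over `X` spelling the generators `u_{ij}` of `U_i` and
`v_{ij} = φ_i(u_{ij})` of `V_i`. -/
structure MHNNData where
  /-- the generating set of the base group -/
  X : Type
  /-- the generating set is finite -/
  fin : Fintype X
  /-- the relators of the base group -/
  R : Set (FreeGroup X)
  /-- the number of stable letters -/
  n : ℕ
  /-- the number of free generators of each associated subgroup -/
  m : Fin n → ℕ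
  /-- words spelling the free generators of the `U_i` -/
  uw : (i : Fin n) → Fin (m i) → FreeGroup X
  /-- words spelling the free generators of the `V_i` -/
  vw : (i : Fin n) → Fin (m i) → FreeGroup X

namespace MHNNData

variable (D : MHNNData)

/-- The base group `A = ⟨X ∣ R⟩`. -/
def A : Type := PresentedGroup D.R

instance : Group D.A := by unfold A; infer_instance

/-- The canonical projection `FreeGroup X → A`. -/
def projA : FreeGroup D.X →* D.A := PresentedGroup.mk D.R

/-- The marking of the base group by its generators. -/
def genA : D.X → D.A := fun x => PresentedGroup.of x

/-- The free generators `u_{ij}` of the associated subgroup `U_i`. -/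
def u (i : Fin D.n) (j : Fin (D.m i)) : D.A := D.projA (D.uw i j)

/-- The free generators `v_{ij} = φ_i(u_{ij})` of the associated subgroup `V_i`. -/
def v (i : Fin D.n) (j : Fin (D.m i)) : D.A := D.projA (D.vw i j)

/-- The associated subgroup `U_i`. -/
def U (i : Fin D.n) : Subgroup D.A := Subgroup.closure (Set.range (D.u i))

/-- The associated subgroup `V_i`. -/
def V (i : Fin D.n) : Subgroup D.A := Subgroup.closure (Set.range (D.v i))

/-- The relators of the multiple HNN extension
`G = ⟨X, s_1, …, s_n ∣ R, s_i⁻¹ u_{ij} s_i = v_{ij}⟩`. -/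
def relsG : Set (FreeGroup (D.X ⊕ Fin D.n)) :=
  FreeGroup.map Sum.inl '' D.R ∪
    { r | ∃ (i : Fin D.n) (j : Fin (D.m i)),
        r = (FreeGroup.of (Sum.inr i))⁻¹ * FreeGroup.map Sum.inl (D.uw i j) *
            FreeGroup.of (Sum.inr i) * (FreeGroup.map Sum.inl (D.vw i j))⁻¹ }

/-- The multiple HNN extension `G`. -/
def G : Type := PresentedGroup D.relsG

instance : Group D.G := by unfold G; infer_instance

/-- The marking of `G` by the generating set `X ∪ {s_1, …, s_n}`. -/
def genG : D.X ⊕ Fin D.n → D.G := fun x => PresentedGroup.of x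

/-- Each associated subgroup `U_i`, `V_i` is free with the given (finite) free basis:
the induced maps from the free group are injective. -/
def FreeBases : Prop :=
  ∀ i : Fin D.n,
    Function.Injective (FreeGroup.lift (D.u i) : FreeGroup (Fin (D.m i)) →* D.A) ∧
    Function.Injective (FreeGroup.lift (D.v i) : FreeGroup (Fin (D.m i)) →* D.A)

/-- All associated subgroups are totally geodesic. -/
def TotallyGeodesic : Prop :=
  ∀ i : Fin D.n,
    TotallyGeodesicSub D.genA (D.u i) ∧ TotallyGeodesicSub D.genA (D.v i)

/-- The presentation is strip equidistant: `|u_{ij}| = |v_{ij}|` in `(A,X)`. -/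
def StripEquidistant : Prop :=
  ∀ (i : Fin D.n) (j : Fin (D.m i)), wlen D.genA (D.u i j) = wlen D.genA (D.v i j)

/-- `G` is an isometric multiple HNN extension: the associated subgroups are finitely
generated free, totally geodesic, and strip equidistant. -/
def IsIsometric : Prop :=
  D.FreeBases ∧ D.TotallyGeodesic ∧ D.StripEquidistant

end MHNNData


namespace MHNNData

variable (D : MHNNData)

/-- View a letter over `X^{±1}` as a letter over `(X ∪ {s_1,…,s_n})^{±1}`. -/
def liftLetter : D.X ⊕ D.X → (D.X ⊕ Fin D.n) ⊕ (D.X ⊕ Fin D.n) :=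
  Sum.map Sum.inl Sum.inl

/-- The stable letter `s_i` as a letter of the alphabet of `G`. -/
def sLetter (i : Fin D.n) : (D.X ⊕ Fin D.n) ⊕ (D.X ⊕ Fin D.n) := Sum.inl (Sum.inr i)

/-- The inverse stable letter `s_i⁻¹` as a letter of the alphabet of `G`. -/
def sInvLetter (i : Fin D.n) : (D.X ⊕ Fin D.n) ⊕ (D.X ⊕ Fin D.n) := Sum.inr (Sum.inr i)

/-- The word `w` contains a pinch: a subword `s_i⁻¹ u s_i` with `u` a word over `X^{±1}`
representing an element of `U_i`, or `s_i v s_i⁻¹` with `v` representing an element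
of `V_i`. -/
def HasPinch (w : List ((D.X ⊕ Fin D.n) ⊕ (D.X ⊕ Fin D.n))) : Prop :=
  ∃ (w₁ w₃ : List ((D.X ⊕ Fin D.n) ⊕ (D.X ⊕ Fin D.n)))
    (w₂ : List (D.X ⊕ D.X)) (i : Fin D.n),
    (w = w₁ ++ [D.sInvLetter i] ++ w₂.map D.liftLetter ++ [D.sLetter i] ++ w₃ ∧
      eval D.genA w₂ ∈ D.U i) ∨
    (w = w₁ ++ [D.sLetter i] ++ w₂.map D.liftLetter ++ [D.sInvLetter i] ++ w₃ ∧
      eval D.genA w₂ ∈ D.V i)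

/-- A word is stable letter reduced if it contains no pinch. -/
def StableLetterReduced (w : List ((D.X ⊕ Fin D.n) ⊕ (D.X ⊕ Fin D.n))) : Prop :=
  ¬ D.HasPinch w

end MHNNData

section WordLength

variable {β G κ : Type*} [Group G]

@[simp]
lemma eval_nil (gen : β → G) : eval gen [] = 1 := rfl

@[simp]
lemma eval_cons (gen : β → G) (a : β ⊕ β) (w : List (β ⊕ β)) :
    eval gen (a :: w) = letterEval gen a * eval gen w := by
  simp [eval]

@[simp]
lemma eval_append (gen : β → G) (w w' : List (β ⊕ β)) :
    eval gen (w ++ w') = eval gen w * eval gen w' := by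
  simp [eval]

lemma exists_eval_inv (gen : β → G) (w : List (β ⊕ β)) :
    ∃ w' : List (β ⊕ β), eval gen w' = (eval gen w)⁻¹ ∧ w'.length = w.length := by
  induction w with
  | nil => exact ⟨[], by simp, rfl⟩
  | cons a w ih =>
    obtain ⟨w', h, hl⟩ := ih
    refine ⟨w' ++ [a.swap], ?_, by simp [hl]⟩
    rcases a with a | a <;> simp [h, letterEval]

lemma wlen_eval_le (gen : β → G) (w : List (β ⊕ β)) : wlen gen (eval gen w) ≤ w.length :=
  Nat.sInf_le ⟨w, rfl, rfl⟩

lemma Generates.exists_length_eq_wlen {gen : β → G} (h : Generates gen) (g : G) :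
    ∃ w : List (β ⊕ β), eval gen w = g ∧ w.length = wlen gen g := by
  obtain ⟨w, hw⟩ := h g
  exact Nat.sInf_mem (s := {n | ∃ w : List (β ⊕ β), eval gen w = g ∧ w.length = n})
    ⟨_, w, hw, rfl⟩

lemma exists_freelyReduced_of_mem_closure (f : κ → G) {g : G}
    (hg : g ∈ Subgroup.closure (Set.range f)) :
    ∃ l : List (κ ⊕ κ), FreelyReduced l ∧ eval f l = g := by
  classical
  rw [← FreeGroup.range_lift_eq_closure] at hg
  obtain ⟨x, rfl⟩ := hg
  refine ⟨x.toWord.map fun p => bif p.2 then Sum.inl p.1 else Sum.inr p.1, ?_, ?_⟩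
  · refine (List.isChain_map _).2 ((FreeGroup.isReduced_toWord (x := x)).imp ?_)
    rintro ⟨a, _ | _⟩ ⟨b, _ | _⟩ h <;> simp_all [IsInvPair]
  · conv_rhs => rw [← x.mk_toWord]
    rw [FreeGroup.lift_mk, eval, List.map_map]
    congr 2
    funext ⟨a, b⟩
    cases b <;> rfl

lemma exists_length_eq_sum_wlen {gen : β → G} (h : Generates gen) (f : κ → G)
    (l : List (κ ⊕ κ)) :
    ∃ w : List (β ⊕ β), eval gen w = eval f l ∧ w.length =
      (l.map (Sum.elim (fun j => wlen gen (f j)) fun j => wlen gen (f j))).sum := by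
  induction l with
  | nil => exact ⟨[], rfl, rfl⟩
  | cons a l ih =>
    obtain ⟨w, hw, hl⟩ := ih
    rcases a with j | j <;> obtain ⟨p, hp, hpl⟩ := h.exists_length_eq_wlen (f j)
    · exact ⟨p ++ w, by simp [hp, hw, letterEval], by simp [hpl, hl]⟩
    · obtain ⟨q, hq, hql⟩ := exists_eval_inv gen p
      exact ⟨q ++ w, by simp [hq, hp, hw, letterEval], by simp [hql, hpl, hl]⟩

/-- A word representing an element of a totally geodesic subgroup can be transported, without
increasing its length, along a length-preserving change of the free basis. -/
lemma TGReducedGeodesic.exists_transport {gen : β → G} (h : Generates gen) {f f' : κ → G}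
    (hf : TGReducedGeodesic gen f) (hff' : ∀ j, wlen gen (f j) = wlen gen (f' j))
    (w : List (β ⊕ β)) (hw : eval gen w ∈ Subgroup.closure (Set.range f)) :
    ∃ (l : List (κ ⊕ κ)) (w' : List (β ⊕ β)),
      eval gen w = eval f l ∧ eval gen w' = eval f' l ∧ w'.length ≤ w.length := by
  obtain ⟨l, hl, hlw⟩ := exists_freelyReduced_of_mem_closure f hw
  obtain ⟨w', hw', hlen⟩ := exists_length_eq_sum_wlen h f' l
  refine ⟨l, w', hlw.symm, hw', ?_⟩
  have hsum := hf l hl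
  simp only [hff'] at hsum
  rw [hlen, ← hsum, hlw]
  exact wlen_eval_le gen w

lemma not_isGeodesic_of_shorter {gen : β → G} {w w' : List (β ⊕ β)}
    (he : eval gen w' = eval gen w) (hl : w'.length < w.length) : ¬ IsGeodesic gen w := by
  intro hg
  have h := wlen_eval_le gen w'
  rw [he, ← hg] at h
  omega

lemma inv_mul_map_eval_mul {H : Type*} [Group H] (ι : G →* H) {f f' : κ → G} {s : H}
    (h : ∀ j, s⁻¹ * ι (f j) * s = ι (f' j)) (l : List (κ ⊕ κ)) :
    s⁻¹ * ι (eval f l) * s = ι (eval f' l) := by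
  induction l with
  | nil => simp
  | cons a l ih =>
    rcases a with j | j <;> simp only [eval_cons, letterEval, Sum.elim_inl, Sum.elim_inr,
      map_mul, map_inv, ← ih, ← h] <;> group

end WordLength

namespace MHNNData

variable (D : MHNNData)

lemma generates_genA : Generates D.genA := fun g =>
  (exists_freelyReduced_of_mem_closure D.genA (g := g) (by
    have h : Subgroup.closure (Set.range D.genA) = ⊤ :=
      PresentedGroup.closure_range_of D.R
    rw [h]
    exact Subgroup.mem_top g)).imp fun _ h => h.2

/-- The canonical projection onto the multiple HNN extension. -/
def projG : FreeGroup (D.X ⊕ Fin D.n) →* D.G := PresentedGroup.mk D.relsG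

lemma lift_genG_inl (x : FreeGroup D.X) :
    FreeGroup.lift (fun x => D.genG (Sum.inl x)) x = D.projG (FreeGroup.map Sum.inl x) := by
  have h : FreeGroup.lift (fun x => D.genG (Sum.inl x)) =
      D.projG.comp (FreeGroup.map Sum.inl) := by
    ext x
    simp only [FreeGroup.lift_apply_of, MonoidHom.comp_apply, FreeGroup.map.of]
    rfl
  exact DFunLike.congr_fun h x

lemma projG_eq_one {r : FreeGroup (D.X ⊕ Fin D.n)} (hr : r ∈ D.relsG) : D.projG r = 1 :=
  PresentedGroup.one_of_mem hr

/-- The canonical homomorphism from the base group to the multiple HNN extension. -/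
def baseHom : D.A →* D.G :=
  PresentedGroup.toGroup (f := fun x => D.genG (Sum.inl x)) (by
    intro r hr
    rw [lift_genG_inl]
    exact D.projG_eq_one (Or.inl ⟨r, hr, rfl⟩))

lemma baseHom_projA (x : FreeGroup D.X) :
    D.baseHom (D.projA x) = D.projG (FreeGroup.map Sum.inl x) :=
  D.lift_genG_inl x

lemma baseHom_genA (x : D.X) : D.baseHom (D.genA x) = D.genG (Sum.inl x) :=
  PresentedGroup.toGroup.of _

lemma eval_map_liftLetter (w : List (D.X ⊕ D.X)) :
    eval D.genG (w.map D.liftLetter) = D.baseHom (eval D.genA w) := by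
  induction w with
  | nil => simp
  | cons a w ih =>
    rcases a with a | a <;> rw [List.map_cons, eval_cons, ih] <;>
      simp [liftLetter, letterEval, baseHom_genA]

lemma stable_conj_u (i : Fin D.n) (j : Fin (D.m i)) :
    (D.genG (Sum.inr i))⁻¹ * D.baseHom (D.u i j) * D.genG (Sum.inr i) =
      D.baseHom (D.v i j) := by
  have h := D.projG_eq_one (Or.inr ⟨i, j, rfl⟩)
  rw [map_mul, map_mul, map_mul, map_inv, map_inv, mul_inv_eq_one] at h
  rw [u, v, baseHom_projA, baseHom_projA]
  exact h

lemma not_isGeodesic_of_hasPinch (hiso : D.IsIsometric)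
    {w : List ((D.X ⊕ Fin D.n) ⊕ (D.X ⊕ Fin D.n))} (hw : D.HasPinch w) :
    ¬ IsGeodesic D.genG w := by
  obtain ⟨-, hgeo, hstrip⟩ := hiso
  obtain ⟨w₁, w₃, w₂, i, ⟨rfl, hmem⟩ | ⟨rfl, hmem⟩⟩ := hw
  · obtain ⟨l, w', he, he', hl⟩ :=
      (hgeo i).1.2.exists_transport D.generates_genA (hstrip i) w₂ hmem
    refine not_isGeodesic_of_shorter (w' := w₁ ++ w'.map D.liftLetter ++ w₃) ?_
      (by simp; omega)
    have h := inv_mul_map_eval_mul D.baseHom (D.stable_conj_u i) l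
    simp only [eval_append, eval_map_liftLetter, he, he', ← h, eval_cons, eval_nil, sLetter,
      sInvLetter, letterEval, Sum.elim_inl, Sum.elim_inr, mul_one, mul_assoc]
  · obtain ⟨l, w', he, he', hl⟩ :=
      (hgeo i).2.2.exists_transport D.generates_genA (fun j => (hstrip i j).symm) w₂ hmem
    refine not_isGeodesic_of_shorter (w' := w₁ ++ w'.map D.liftLetter ++ w₃) ?_
      (by simp; omega)
    have h := inv_mul_map_eval_mul D.baseHom (D.stable_conj_u i) l
    simp only [eval_append, eval_map_liftLetter, he, he', ← h, eval_cons, eval_nil, sLetter,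
      sInvLetter, letterEval, Sum.elim_inl, Sum.elim_inr, mul_one, mul_assoc,
      mul_inv_cancel_left]

end MHNNData

open MHNNData in
/-- In an isometric multiple HNN extension of a finitely presented base
group, every geodesic word over `(X ∪ {s_1,…,s_n})^{±1}` is stable letter reduced;
equivalently, any word containing a pinch is not geodesic. -/
theorem isometric_mhnn_geodesics_stableLetterReduced (D : MHNNData) (hfp : D.R.Finite)
    (hiso : D.IsIsometric) :
    (∀ w : List ((D.X ⊕ Fin D.n) ⊕ (D.X ⊕ Fin D.n)),
        IsGeodesic D.genG w → D.StableLetterReduced w) ∧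
    (∀ w : List ((D.X ⊕ Fin D.n) ⊕ (D.X ⊕ Fin D.n)),
        D.HasPinch w → ¬ IsGeodesic D.genG w) := by
  exact ⟨fun _ hg hp => D.not_isGeodesic_of_hasPinch hiso hp hg,
    fun _ hp => D.not_isGeodesic_of_hasPinch hiso hp⟩

end ACPaper
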